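/- Let A, B, C ∈ U₂ with rank(A − B) = 2 (i.e. A and B are not coherent). If rank(C − X) ≤ 1 for every X ∈ U₂ satisfying rank(X − A) ≤ 1 and rank(X − B) ≤ 1, then C = A or C = B. -/

import Mathlib

open Matrix
open scoped ComplexOrder

noncomputable section

/-- The space of `2×2` complex matrices. -/
abbrev Mat2 : Type := Matrix (Fin 2) (Fin 2) ℂ

/-- The group of `2×2` complex unitary matrices. -/
abbrev U2 : Type := Matrix.unitaryGroup (Fin 2) ℂ

/-- Coherency for matrices: `A ∼ B` iff `rank (A − B) ≤ 1`. -/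
def Coherent (A B : Mat2) : Prop := (A - B).rank ≤ 1

/-- Coherency for unitaries: `U ∼ V` iff `rank (U − V) ≤ 1`. -/
def CoherentU (U V : U2) : Prop := ((U : Mat2) - (V : Mat2)).rank ≤ 1

/-- The Cayley transform, as a matrix: `𝔠(A) = (A − iI)(A + iI)⁻¹`. -/
def cayleyMat (A : Mat2) : Mat2 :=
  (A - Complex.I • (1 : Mat2)) * (A + Complex.I • (1 : Mat2))⁻¹

open Classical in
/-- The Cayley transform, landing in the unitary group.  For every hermitian `A` the matrix
`cayleyMat A` is unitary, so the junk value `1` is never used for the matrices considered here. -/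
def cayley (A : Mat2) : U2 :=
  if h : cayleyMat A ∈ Matrix.unitaryGroup (Fin 2) ℂ then ⟨cayleyMat A, h⟩ else 1

/-- An automorphism of `U₂`: a bijection preserving coherency in both directions. -/
def IsAut (Φ : U2 → U2) : Prop :=
  Function.Bijective Φ ∧ ∀ U V : U2, CoherentU U V ↔ CoherentU (Φ U) (Φ V)

/-- A line in `U₂`: a maximal subset all of whose elements are pairwise coherent. -/
def IsLine (ℓ : Set U2) : Prop :=
  (∀ U ∈ ℓ, ∀ V ∈ ℓ, CoherentU U V) ∧
  ∀ m : Set U2, ℓ ⊆ m → (∀ U ∈ m, ∀ V ∈ m, CoherentU U V) → m = ℓ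

/-- The matrix interval `[A, B] = {X : A ≤ X ≤ B}` (in the Loewner order). -/
def matIcc (A B : Mat2) : Set Mat2 := {X | (X - A).PosSemidef ∧ (B - X).PosSemidef}

/-- Rank one projections: `P = P* = P²` of rank one. -/
def IsProj1 (P : Mat2) : Prop := P.IsHermitian ∧ P * P = P ∧ P.rank = 1

/-- A rank-one perturbation of a `2×2` determinant. -/
theorem det_add_smul_vecMulVec (M : Mat2) (c : ℂ) (u v : Fin 2 → ℂ) :
    (M + c • vecMulVec u v).det = M.det + c * (v ⬝ᵥ M.adjugate *ᵥ u) := by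
  simp [det_fin_two, adjugate_fin_two, vecMulVec_apply, dotProduct, mulVec, Fin.sum_univ_two]
  ring

theorem det_eq_zero_iff_rank_le_one (M : Mat2) : M.det = 0 ↔ M.rank ≤ 1 := by
  constructor
  · intro hM
    by_contra hr
    have hle := M.rank_le_card_width
    have hrank : M.rank = 2 := by
      simp only [Fintype.card_fin] at hle
      omega
    have hli : LinearIndependent ℂ M.col := by
      rw [linearIndependent_iff_card_eq_finrank_span, Set.finrank, ← rank_eq_finrank_span_cols,
        hrank, Fintype.card_fin]
    have hu := (isUnit_iff_isUnit_det M).1 (linearIndependent_cols_iff_isUnit.1 hli)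
    exact hu.ne_zero hM
  · intro hr
    by_contra hM
    have hrank := rank_of_isUnit M ((isUnit_iff_isUnit_det M).2 (isUnit_iff_ne_zero.2 hM))
    rw [Fintype.card_fin] at hrank
    omega

/-- A matrix whose quadratic form `w ↦ wᴴ T w` vanishes is zero. -/
theorem eq_zero_of_forall_star_dotProduct_mulVec (T : Mat2)
    (hT : ∀ w : Fin 2 → ℂ, star w ⬝ᵥ T *ᵥ w = 0) : T = 0 := by
  have h₀ := hT ![1, 0]
  have h₁ := hT ![0, 1]
  have hs := hT ![1, 1]
  have hi := hT ![1, Complex.I]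
  simp only [dotProduct, mulVec, Fin.sum_univ_two, Pi.star_apply, cons_val_zero, cons_val_one,
    RCLike.star_def, map_one, map_zero, Complex.conj_I, mul_one, mul_zero, one_mul, zero_mul,
    add_zero, zero_add] at h₀ h₁ hs hi
  have hsum : T 0 1 + T 1 0 = 0 := by linear_combination hs - h₀ - h₁
  have hdiff : T 0 1 - T 1 0 = 0 := by
    linear_combination -Complex.I * (hi - h₀ - h₁) +
      (T 0 1 - T 1 0 - Complex.I * T 1 1) * Complex.I_sq
  ext i j
  fin_cases i <;> fin_cases j
  · exact h₀
  · change T 0 1 = 0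
    linear_combination (hsum + hdiff) / 2
  · change T 1 0 = 0
    linear_combination (hsum - hdiff) / 2
  · exact h₁

/-- The resolvent of a unitary at `1` has hermitian part `1 / 2`. -/
theorem inv_one_sub_add_conjTranspose {B : Mat2} (hB : B ∈ unitaryGroup (Fin 2) ℂ)
    (hd : (1 - B).det ≠ 0) : (1 - B)⁻¹ + ((1 - B)⁻¹)ᴴ = 1 := by
  have hu : IsUnit (1 - B).det := isUnit_iff_ne_zero.2 hd
  have hl := nonsing_inv_mul _ hu
  have hr : (1 - B)ᴴ * ((1 - B)⁻¹)ᴴ = 1 := by rw [← conjTranspose_mul, hl, conjTranspose_one]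
  have hBB : B * Bᴴ = 1 := mem_unitaryGroup_iff.1 hB
  have key : (1 - B)ᴴ + (1 - B) = (1 - B) * (1 - B)ᴴ := by
    rw [conjTranspose_sub, conjTranspose_one, mul_sub, sub_mul, sub_mul, hBB]
    simp only [one_mul, mul_one]
    abel
  calc (1 - B)⁻¹ + ((1 - B)⁻¹)ᴴ
      = (1 - B)⁻¹ * ((1 - B)ᴴ * ((1 - B)⁻¹)ᴴ) + (1 - B)⁻¹ * (1 - B) * ((1 - B)⁻¹)ᴴ := by
        rw [hr, hl, mul_one, one_mul]
    _ = (1 - B)⁻¹ * ((1 - B)ᴴ + (1 - B)) * ((1 - B)⁻¹)ᴴ := by noncomm_ring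
    _ = ((1 - B)⁻¹ * (1 - B)) * ((1 - B)ᴴ * ((1 - B)⁻¹)ᴴ) := by rw [key]; noncomm_ring
    _ = 1 := by rw [hr, hl, one_mul]

/-- A rank-one perturbation `1 - q⁻¹ w wᴴ` is unitary when `2 Re q = ‖w‖²`. -/
theorem one_sub_smul_vecMulVec_mem_unitaryGroup (w : Fin 2 → ℂ) {q : ℂ} (hq : q ≠ 0)
    (hqw : q + star q = star w ⬝ᵥ w) :
    1 + (-q⁻¹) • vecMulVec w (star w) ∈ unitaryGroup (Fin 2) ℂ := by
  have hq' : star q ≠ 0 := star_ne_zero.2 hq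
  have hP : star (vecMulVec w (star w)) = vecMulVec w (star w) := by
    rw [star_eq_conjTranspose, conjTranspose_vecMulVec, star_star]
  have hPP : vecMulVec w (star w) * vecMulVec w (star w)
      = (q + star q) • vecMulVec w (star w) := by
    rw [vecMulVec_mul_vecMulVec, hqw, vecMulVec_smul]
  have hc : -(star q)⁻¹ + -q⁻¹ + q⁻¹ * (star q)⁻¹ * (q + star q) = 0 := by
    field_simp
    ring
  rw [mem_unitaryGroup_iff, star_add, star_one, star_smul, hP, star_neg, star_inv₀, add_mul,
    mul_add, mul_add, one_mul, mul_one, one_mul, smul_mul_smul_comm, hPP, smul_smul, neg_mul_neg,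
    add_assoc, ← add_assoc (_ • _), ← add_smul, ← add_smul]
  rw [hc, zero_smul, add_zero]

/-- A matrix `C` for which `C - X` is singular at every unitary `X` with `X - 1` and `X - B`
singular is `1` or `B`. -/
theorem eq_one_or_eq_of_forall_det {B C : Mat2} (hB : B ∈ unitaryGroup (Fin 2) ℂ)
    (hd : (1 - B).det ≠ 0)
    (h : ∀ X ∈ unitaryGroup (Fin 2) ℂ, (X - 1).det = 0 → (X - B).det = 0 → (C - X).det = 0) :
    C = 1 ∨ C = B := by
  have hu : IsUnit (1 - B).det := isUnit_iff_ne_zero.2 hd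
  have hT : (C - 1).det • (1 - B)⁻¹ + (C - 1).adjugate = 0 := by
    refine eq_zero_of_forall_star_dotProduct_mulVec _ fun w => ?_
    obtain rfl | hw := eq_or_ne w 0
    · simp
    set q := star w ⬝ᵥ (1 - B)⁻¹ *ᵥ w with hq_def
    have hqw : q + star q = star w ⬝ᵥ w := by
      have hstar : star q = star w ⬝ᵥ ((1 - B)⁻¹)ᴴ *ᵥ w := by
        rw [hq_def, star_dotProduct, star_star, star_mulVec, ← dotProduct_mulVec]
      rw [hstar, hq_def, ← dotProduct_add, ← add_mulVec, inv_one_sub_add_conjTranspose hB hd,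
        one_mulVec]
    have hq : q ≠ 0 := by
      intro h0
      rw [h0, star_zero, add_zero, eq_comm, dotProduct_star_self_eq_zero] at hqw
      exact hw hqw
    have hadj : star w ⬝ᵥ (1 - B).adjugate *ᵥ w = (1 - B).det * q := by
      rw [hq_def, ← smul_eq_mul, ← dotProduct_smul, ← smul_mulVec, inv_def, smul_smul,
        Ring.mul_inverse_cancel _ hu, one_smul]
    have hX := h _ (one_sub_smul_vecMulVec_mem_unitaryGroup w hq hqw)
      (by
        rw [add_sub_cancel_left]
        simp [det_fin_two, vecMulVec_apply]
        ring)
      (by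
        rw [add_sub_right_comm, det_add_smul_vecMulVec, hadj]
        field_simp
        ring)
    rw [← sub_sub, sub_eq_add_neg, ← neg_smul, neg_neg, det_add_smul_vecMulVec] at hX
    rw [add_mulVec, dotProduct_add, smul_mulVec, dotProduct_smul, ← hq_def, smul_eq_mul]
    field_simp at hX
    linear_combination hX
  have hmul : (C - 1).det • (C - B) = 0 := by
    have := congrArg (fun M => (C - 1) * M * (1 - B)) hT
    simp only [mul_add, add_mul, Matrix.mul_smul, smul_mul, mul_adjugate, mul_assoc,
      nonsing_inv_mul _ hu, mul_one, mul_zero, zero_mul, one_mul] at this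
    rwa [← smul_add, sub_add_sub_cancel] at this
  rcases smul_eq_zero.1 hmul with hdet | hCB
  · left
    rw [hdet, zero_smul, zero_add] at hT
    have hzero := congrArg adjugate hT
    rw [adjugate_adjugate _ (by simp), adjugate_zero] at hzero
    simpa [sub_eq_zero] using hzero
  · exact Or.inr (sub_eq_zero.1 hCB)

theorem coherentU_iff_det (U V : U2) : CoherentU U V ↔ ((U : Mat2) - (V : Mat2)).det = 0 :=
  (det_eq_zero_iff_rank_le_one _).symm

/-- A unitary coherent to every point of `𝒮_{1,B}` is `1` or `B`. -/
theorem eq_one_or_eq_of_forall_coherentU {B C : U2} (hd : ¬ CoherentU 1 B)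
    (h : ∀ X : U2, CoherentU X 1 → CoherentU X B → CoherentU C X) : C = 1 ∨ C = B := by
  simp only [coherentU_iff_det, OneMemClass.coe_one] at hd h
  have key := eq_one_or_eq_of_forall_det B.2 hd fun X hX => h ⟨X, hX⟩
  rwa [Subtype.ext_iff, Subtype.ext_iff, OneMemClass.coe_one]

/-- Left translation preserves coherency. -/
theorem coherentU_mul_left_iff (W U V : U2) : CoherentU (W * U) (W * V) ↔ CoherentU U V := by
  have hW : (W : Mat2).det ≠ 0 := (UnitaryGroup.det_isUnit W).ne_zero
  rw [coherentU_iff_det, coherentU_iff_det, Submonoid.coe_mul, Submonoid.coe_mul, ← mul_sub,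
    det_mul, mul_eq_zero, or_iff_right hW]

/-- If `A` and `B` are non-coherent points of `U₂` and `C` is coherent to every point of
`𝒮_{A,B}`, then `C ∈ {A, B}`. -/
theorem coherent_to_all_of_S_AB
    (A B C : U2) (hAB : ((A : Mat2) - (B : Mat2)).rank = 2)
    (h : ∀ X : U2, CoherentU X A → CoherentU X B → CoherentU C X) :
    C = A ∨ C = B := by
  have hd : ¬ CoherentU 1 (A⁻¹ * B) := by
    rw [← inv_mul_cancel A, coherentU_mul_left_iff, CoherentU, hAB]
    simp
  have key : A⁻¹ * C = 1 ∨ A⁻¹ * C = A⁻¹ * B := by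
    refine eq_one_or_eq_of_forall_coherentU hd fun X h1 hB => ?_
    have hA' : CoherentU (A * X) A := by
      rwa [← coherentU_mul_left_iff A⁻¹, inv_mul_cancel_left, inv_mul_cancel]
    have hB' : CoherentU (A * X) B := by
      rwa [← coherentU_mul_left_iff A⁻¹, inv_mul_cancel_left]
    have hC := h _ hA' hB'
    rwa [← coherentU_mul_left_iff A⁻¹, inv_mul_cancel_left] at hC
  exact key.imp (fun h1 => (inv_mul_eq_one.1 h1).symm) fun hB => mul_left_cancel hB
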